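/- Let G be a countable sofic group with sofic approximation sequence Σ, let k ∈ ℕ, let X = {0,1,…,k−1}^G with the product topology and the left shift action s·(x_t)_{t∈G} = (x_{s^{-1}t})_{t∈G}, and let a_0,…,a_{k−1} ∈ ℝ. Define f ∈ C(X) by f(x) = a_{x_e}. Then P_Σ(f,X,G) = log(Σ_{j=0}^{k−1} exp(a_j)) = sup { H(p) + Σ_{i=0}^{k−1} p(i)a_i : p a probability measure on {0,…,k−1} }, where H(p) = −Σ_{i=0}^{k−1} p(i) log p(i). -/

import Mathlib

open Filter MeasureTheory
open scoped Pointwise Classical BigOperators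

namespace Sofic

structure ContAction (G : Type*) [Group G] (X : Type*) [TopologicalSpace X]
    (α : G → X → X) : Prop where
  one : ∀ x, α 1 x = x
  mul : ∀ s t x, α (s * t) x = α s (α t x)
  cont : ∀ s, Continuous (α s)

structure IsContPseudoMetric (X : Type*) [TopologicalSpace X] (ρ : X → X → ℝ) : Prop where
  nonneg : ∀ x y, 0 ≤ ρ x y
  refl : ∀ x, ρ x x = 0
  symm : ∀ x y, ρ x y = ρ y x
  triangle : ∀ x y z, ρ x z ≤ ρ x y + ρ y z
  cont : Continuous fun p : X × X => ρ p.1 p.2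

structure IsCompatMetric (X : Type*) [TopologicalSpace X] (ρ : X → X → ℝ)
    extends IsContPseudoMetric X ρ : Prop where
  eq_of_zero : ∀ x y, ρ x y = 0 → x = y
  ball_mem : ∀ x : X, ∀ U ∈ nhds x, ∃ ε > 0, {y | ρ x y < ε} ⊆ U

structure IsSoficApprox (G : Type*) [Group G] (d : ℕ → ℕ)
    (σ : ∀ i, G → Equiv.Perm (Fin (d i))) : Prop where
  mul : ∀ s t : G, Tendsto
    (fun i => ((Finset.univ.filter fun a : Fin (d i) => σ i s (σ i t a) = σ i (s * t) a).card : ℝ) / (d i : ℝ))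
    atTop (nhds 1)
  sep : ∀ s t : G, s ≠ t → Tendsto
    (fun i => ((Finset.univ.filter fun a : Fin (d i) => σ i s a ≠ σ i t a).card : ℝ) / (d i : ℝ))
    atTop (nhds 1)
  dim_top : Tendsto d atTop atTop

noncomputable def rho2 {X : Type*} (ρ : X → X → ℝ) {d : ℕ} (φ ψ : Fin d → X) : ℝ :=
  Real.sqrt ((1 / (d : ℝ)) * ∑ a, (ρ (φ a) (ψ a)) ^ 2)

noncomputable def rhoInf {X : Type*} (ρ : X → X → ℝ) {d : ℕ} (φ ψ : Fin d → X) : ℝ :=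
  ⨆ a : Fin d, ρ (φ a) (ψ a)

def MapSet {G X : Type*} [Group G] (α : G → X → X) (ρ : X → X → ℝ)
    (F : Finset G) (δ : ℝ) {d : ℕ} (σ : G → Equiv.Perm (Fin d)) : Set (Fin d → X) :=
  {φ | ∀ s ∈ F, rho2 ρ (fun a => α s (φ a)) (fun a => φ (σ s a)) < δ}

noncomputable def Mval {G X : Type*} [Group G] (α : G → X → X) (f : X → ℝ) (ρ : X → X → ℝ)
    (ε : ℝ) (F : Finset G) (δ : ℝ) {d : ℕ} (σ : G → Equiv.Perm (Fin d))
    (sepd : (Fin d → X) → (Fin d → X) → ℝ) : ℝ :=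
  sSup {r : ℝ | ∃ E : Finset (Fin d → X), ↑E ⊆ MapSet α ρ F δ σ ∧
    (∀ φ ∈ E, ∀ ψ ∈ E, φ ≠ ψ → ε ≤ sepd φ ψ) ∧
    r = ∑ φ ∈ E, Real.exp (∑ a, f (φ a))}

noncomputable def PressureInf {G X : Type*} [Group G] (α : G → X → X) (f : X → ℝ)
    (ρ : X → X → ℝ) (d : ℕ → ℕ) (σ : ∀ i, G → Equiv.Perm (Fin (d i))) : EReal :=
  ⨆ (ε : ℝ) (_ : 0 < ε), ⨅ (F : Finset G) (_ : F.Nonempty), ⨅ (δ : ℝ) (_ : 0 < δ),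
    Filter.limsup (fun i =>
      if (MapSet α ρ F δ (σ i)).Nonempty then
        (((Real.log (Mval α f ρ ε F δ (σ i) (rhoInf ρ))) / (d i : ℝ) : ℝ) : EReal)
      else (⊥ : EReal)) atTop

noncomputable def Pressure2 {G X : Type*} [Group G] (α : G → X → X) (f : X → ℝ)
    (ρ : X → X → ℝ) (d : ℕ → ℕ) (σ : ∀ i, G → Equiv.Perm (Fin (d i))) : EReal :=
  ⨆ (ε : ℝ) (_ : 0 < ε), ⨅ (F : Finset G) (_ : F.Nonempty), ⨅ (δ : ℝ) (_ : 0 < δ),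
    Filter.limsup (fun i =>
      if (MapSet α ρ F δ (σ i)).Nonempty then
        (((Real.log (Mval α f ρ ε F δ (σ i) (rho2 ρ))) / (d i : ℝ) : ℝ) : EReal)
      else (⊥ : EReal)) atTop

def MapMuSet {G X : Type*} [Group G] [TopologicalSpace X] [MeasurableSpace X]
    (α : G → X → X) (μ : Measure X) (ρ : X → X → ℝ) (F : Finset G)
    (L : Finset C(X, ℝ)) (δ : ℝ) {d : ℕ} (σ : G → Equiv.Perm (Fin d)) : Set (Fin d → X) :=
  {φ | φ ∈ MapSet α ρ F δ σ ∧
    ∀ g ∈ L, |(1 / (d : ℝ)) * ∑ j, g (φ j) - ∫ x, g x ∂μ| < δ}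

noncomputable def Nval {X : Type*} (ε : ℝ) {d : ℕ} (Y : Set (Fin d → X))
    (sepd : (Fin d → X) → (Fin d → X) → ℝ) : ℝ :=
  sSup {r : ℝ | ∃ E : Finset (Fin d → X), ↑E ⊆ Y ∧
    (∀ φ ∈ E, ∀ ψ ∈ E, φ ≠ ψ → ε ≤ sepd φ ψ) ∧ r = (E.card : ℝ)}

noncomputable def MeasEntropy {G X : Type*} [Group G] [TopologicalSpace X] [MeasurableSpace X]
    (α : G → X → X) (μ : Measure X) (ρ : X → X → ℝ) (d : ℕ → ℕ)
    (σ : ∀ i, G → Equiv.Perm (Fin (d i))) : EReal :=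
  ⨆ (ε : ℝ) (_ : 0 < ε), ⨅ (F : Finset G) (_ : F.Nonempty),
    ⨅ (L : Finset C(X, ℝ)) (_ : L.Nonempty), ⨅ (δ : ℝ) (_ : 0 < δ),
      Filter.limsup (fun i =>
        if (MapMuSet α μ ρ F L δ (σ i)).Nonempty then
          (((Real.log (Nval ε (MapMuSet α μ ρ F L δ (σ i)) (rhoInf ρ))) / (d i : ℝ) : ℝ) : EReal)
        else (⊥ : EReal)) atTop

def IsInvProb {G X : Type*} [Group G] [MeasurableSpace X]
    (α : G → X → X) (μ : Measure X) : Prop :=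
  IsProbabilityMeasure μ ∧ ∀ s : G, Measure.map (α s) μ = μ

noncomputable def Kval {G X : Type*} [Group G] (α : G → X → X) (f : X → ℝ)
    (ρ : X → X → ℝ) (ε : ℝ) (F : Finset G) : ℝ :=
  sSup {r : ℝ | ∃ D : Finset X,
    (∀ x ∈ D, ∀ y ∈ D, x ≠ y → ε ≤ ⨆ s ∈ F, ρ (α s x) (α s y)) ∧
    r = ∑ x ∈ D, Real.exp (∑ s ∈ F, f (α s x))}

def IsFolnerSeq (G : Type*) [Group G] [DecidableEq G] (Fol : ℕ → Finset G) : Prop :=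
  (∀ n, (Fol n).Nonempty) ∧ ∀ s : G,
    Tendsto (fun n =>
      (((((Fol n).image fun t => s * t) \ Fol n) ∪ (Fol n \ ((Fol n).image fun t => s * t))).card : ℝ)
        / ((Fol n).card : ℝ)) atTop (nhds 0)

theorem IsContPseudoMetric.exists_bound {X : Type*} [TopologicalSpace X] [CompactSpace X]
    {ρ : X → X → ℝ} (hρ : IsContPseudoMetric X ρ) : ∃ D : ℝ, ∀ x y, ρ x y ≤ D := by
  obtain ⟨D, hD⟩ := (isCompact_range hρ.cont).bddAbove
  exact ⟨D, fun x y => hD ⟨(x, y), rfl⟩⟩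

section FullShift

variable {G : Type*} {k : ℕ} [TopologicalSpace (Fin k)] [DiscreteTopology (Fin k)]
  {ρ : (G → Fin k) → (G → Fin k) → ℝ}

theorem isClosed_setOf_apply_eq (t : G) :
    IsClosed {p : (G → Fin k) × (G → Fin k) | p.1 t = p.2 t} :=
  isClosed_eq ((continuous_apply t).comp continuous_fst) ((continuous_apply t).comp continuous_snd)

theorem isOpen_setOf_apply_eq (t : G) :
    IsOpen {p : (G → Fin k) × (G → Fin k) | p.1 t = p.2 t} := by
  have hc : Continuous fun p : (G → Fin k) × (G → Fin k) => (p.1 t, p.2 t) := by fun_prop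
  exact (isOpen_discrete {q : Fin k × Fin k | q.1 = q.2}).preimage hc

theorem IsContPseudoMetric.exists_finset_lt (hρ : IsContPseudoMetric (G → Fin k) ρ)
    {ε : ℝ} (hε : 0 < ε) :
    ∃ T : Finset G, ∀ x y, (∀ t ∈ T, x t = y t) → ρ x y < ε := by
  have hK : IsCompact {p : (G → Fin k) × (G → Fin k) | ε ≤ ρ p.1 p.2} :=
    (isClosed_le continuous_const hρ.cont).isCompact
  obtain ⟨T, hT⟩ := hK.elim_finite_subfamily_closed
    (fun t : G => {p : (G → Fin k) × (G → Fin k) | p.1 t = p.2 t}) isClosed_setOf_apply_eq (by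
      ext ⟨x, y⟩
      simp only [Set.mem_inter_iff, Set.mem_ofPred_eq, Set.mem_iInter, Set.mem_empty_iff_false,
        iff_false, not_and]
      intro h hxy
      obtain rfl : x = y := funext hxy
      rw [hρ.refl] at h
      linarith)
  refine ⟨T, fun x y hxy => ?_⟩
  by_contra! h
  have : (x, y) ∈ ({p : (G → Fin k) × (G → Fin k) | ε ≤ ρ p.1 p.2} ∩
      ⋂ t ∈ T, {p : (G → Fin k) × (G → Fin k) | p.1 t = p.2 t}) := by
    simpa using ⟨h, hxy⟩
  rw [hT] at this
  exact this

theorem IsCompatMetric.exists_pos_apply_eq (hρ : IsCompatMetric (G → Fin k) ρ) (t : G) :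
    ∃ η > 0, ∀ x y, ρ x y < η → x t = y t := by
  have hK : IsCompact {p : (G → Fin k) × (G → Fin k) | p.1 t = p.2 t}ᶜ :=
    (isOpen_setOf_apply_eq t).isClosed_compl.isCompact
  rcases Set.eq_empty_or_nonempty {p : (G → Fin k) × (G → Fin k) | p.1 t = p.2 t}ᶜ with h | h
  · refine ⟨1, one_pos, fun x y _ => ?_⟩
    by_contra hne
    have : (x, y) ∈ {p : (G → Fin k) × (G → Fin k) | p.1 t = p.2 t}ᶜ := hne
    rw [h] at this
    exact this
  · obtain ⟨⟨x₀, y₀⟩, hmem, hmin⟩ := hK.exists_isMinOn h hρ.cont.continuousOn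
    refine ⟨ρ x₀ y₀, lt_of_le_of_ne (hρ.nonneg _ _) fun h0 => ?_, fun x y hlt => ?_⟩
    · exact hmem (congrFun (hρ.eq_of_zero _ _ h0.symm) t)
    · by_contra hne
      have : ρ x₀ y₀ ≤ ρ x y := isMinOn_iff.1 hmin (x, y) hne
      linarith

theorem exists_finset_eq_of_le_rhoInf (hρ : IsContPseudoMetric (G → Fin k) ρ) {ε : ℝ}
    (hε : 0 < ε) : ∃ T : Finset G, ∀ (d : ℕ) (E : Finset (Fin d → G → Fin k)),
      (∀ φ ∈ E, ∀ ψ ∈ E, φ ≠ ψ → ε ≤ rhoInf ρ φ ψ) →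
        ∀ φ ∈ E, ∀ ψ ∈ E, (∀ b, ∀ t ∈ T, φ b t = ψ b t) → φ = ψ := by
  obtain ⟨T, hT⟩ := hρ.exists_finset_lt (half_pos hε)
  refine ⟨T, fun d E hE φ hφ ψ hψ h => ?_⟩
  by_contra hne
  have h1 : rhoInf ρ φ ψ ≤ ε / 2 :=
    Real.iSup_le (fun b => (hT _ _ (h b)).le) (half_pos hε).le
  linarith [hE φ hφ ψ hψ hne]

end FullShift

/-- Weighted count of microstates which are determined on the window `T`, up to an exceptional set
of at most `c` points, by their coordinates at `1`. -/
theorem sum_exp_le_of_card_exceptional_le {G : Type*} [One G] {k d : ℕ} (a : Fin k → ℝ)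
    (E : Finset (Fin d → G → Fin k)) (T : Finset G) (τ : G → Fin d → Fin d) {c l : ℝ}
    (hl : 0 ≤ l)
    (hsep : ∀ φ ∈ E, ∀ ψ ∈ E, (∀ b, ∀ t ∈ T, φ b t = ψ b t) → φ = ψ)
    (hc : ∀ φ ∈ E, ((Finset.univ.filter
      fun b => ∃ t ∈ T, φ b t ≠ φ (τ t b) 1).card : ℝ) ≤ c) :
    ∑ φ ∈ E, Real.exp (∑ b, a (φ b 1)) ≤
      (∑ j, Real.exp (a j)) ^ d *
        (Real.exp (l * c) * (1 + (k : ℝ) ^ T.card * Real.exp (-l)) ^ d) := by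
  let Φ : (Fin d → G → Fin k) → (Fin d → Fin k) × (Fin d → Option (T → Fin k)) := fun φ =>
    (fun b => φ b 1, fun b =>
      if ∃ t ∈ T, φ b t ≠ φ (τ t b) 1 then some fun t => φ b t else none)
  let u : Option (T → Fin k) → ℝ := fun o => o.elim 1 fun _ => Real.exp (-l)
  have hu : ∀ o, 0 < u o := by
    rintro (_ | _)
    · exact one_pos
    · exact Real.exp_pos _
  let g : (Fin d → Fin k) × (Fin d → Option (T → Fin k)) → ℝ := fun p =>
    (∏ b, Real.exp (a (p.1 b))) * (Real.exp (l * c) * ∏ b, u (p.2 b))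
  have hg : ∀ p, 0 ≤ g p := fun p => mul_nonneg (Finset.prod_nonneg fun _ _ => (Real.exp_pos _).le)
    (mul_nonneg (Real.exp_pos _).le (Finset.prod_nonneg fun _ _ => (hu _).le))
  have hinj : Set.InjOn Φ (E : Set (Fin d → G → Fin k)) := by
    intro φ hφ ψ hψ h
    have h1 : ∀ b, φ b 1 = ψ b 1 := fun b => congrFun (congrArg Prod.fst h) b
    refine hsep φ hφ ψ hψ fun b t ht => ?_
    have h2 : (if ∃ t ∈ T, φ b t ≠ φ (τ t b) 1 then some fun t : T => φ b t else none) =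
        (if ∃ t ∈ T, ψ b t ≠ ψ (τ t b) 1 then some fun t : T => ψ b t else none) :=
      congrFun (congrArg Prod.snd h) b
    split_ifs at h2 with hA hB hB
    · exact congrFun (Option.some.inj h2) ⟨t, ht⟩
    · push Not at hA hB
      rw [hA t ht, hB t ht, h1]
  have hle : ∀ φ ∈ E, Real.exp (∑ b, a (φ b 1)) ≤ g (Φ φ) := by
    intro φ hφ
    have hprod : ∏ b, u ((Φ φ).2 b) = Real.exp (-l) ^ (Finset.univ.filter
        fun b => ∃ t ∈ T, φ b t ≠ φ (τ t b) 1).card := by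
      have : ∀ b, u ((Φ φ).2 b) =
          if ∃ t ∈ T, φ b t ≠ φ (τ t b) 1 then Real.exp (-l) else 1 := by
        intro b
        simp only [Φ]
        split_ifs <;> rfl
      simp only [this, Finset.prod_ite, Finset.prod_const, one_pow, mul_one]
    simp only [g]
    rw [hprod, Real.exp_sum, ← Real.exp_nat_mul, ← Real.exp_add]
    refine le_mul_of_one_le_right (Finset.prod_nonneg fun _ _ => (Real.exp_pos _).le) ?_
    refine Real.one_le_exp ?_
    nlinarith [hc φ hφ]
  calc ∑ φ ∈ E, Real.exp (∑ b, a (φ b 1)) ≤ ∑ φ ∈ E, g (Φ φ) := Finset.sum_le_sum hle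
    _ = ∑ p ∈ E.image Φ, g p := (Finset.sum_image hinj).symm
    _ ≤ ∑ p, g p := Finset.sum_le_univ_sum_of_nonneg hg
    _ = _ := by
      simp only [g]
      rw [Fintype.sum_prod_type]
      simp only [← Finset.mul_sum, ← Finset.sum_mul]
      rw [← Fintype.sum_pow u, ← Fintype.sum_pow fun j => Real.exp (a j), Fintype.sum_option]
      simp [u]

/-- The Gibbs variational principle on a finite set. -/
theorem isGreatest_log_sum_exp {ι : Type*} [Fintype ι] [Nonempty ι] (a : ι → ℝ) :
    IsGreatest {r : ℝ | ∃ p : ι → ℝ, (∀ i, 0 ≤ p i) ∧ (∑ i, p i) = 1 ∧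
        r = (∑ i, -(p i * Real.log (p i))) + ∑ i, p i * a i}
      (Real.log (∑ j, Real.exp (a j))) := by
  have hZ : 0 < ∑ j, Real.exp (a j) :=
    Finset.sum_pos (fun _ _ => Real.exp_pos _) Finset.univ_nonempty
  set Z := ∑ j, Real.exp (a j) with hZdef
  have hsum : ∑ i, Real.exp (a i) / Z = 1 := by
    rw [← Finset.sum_div, div_self hZ.ne']
  constructor
  · refine ⟨fun i => Real.exp (a i) / Z, fun i => by positivity, hsum, ?_⟩
    rw [← Finset.sum_add_distrib]
    have : ∀ i, -(Real.exp (a i) / Z * Real.log (Real.exp (a i) / Z)) +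
        Real.exp (a i) / Z * a i = Real.exp (a i) / Z * Real.log Z := by
      intro i
      rw [Real.log_div (Real.exp_pos _).ne' hZ.ne', Real.log_exp]
      ring
    simp only [this, ← Finset.sum_mul, hsum, one_mul]
  · rintro r ⟨p, hp, hp1, rfl⟩
    have key : ∀ i, -(p i * Real.log (p i)) + p i * a i ≤
        p i * Real.log Z + (Real.exp (a i) / Z - p i) := by
      intro i
      rcases (hp i).eq_or_lt with h | h
      · rw [← h]
        simp only [zero_mul, neg_zero, add_zero, zero_add, sub_zero]
        positivity
      · have hq : 0 < Real.exp (a i) / Z := by positivity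
        have h1 := Real.log_le_sub_one_of_pos (div_pos hq h)
        rw [Real.log_div hq.ne' h.ne', Real.log_div (Real.exp_pos _).ne' hZ.ne', Real.log_exp] at h1
        have h2 := mul_le_mul_of_nonneg_left h1 h.le
        have h3 : p i * (Real.exp (a i) / Z / p i - 1) = Real.exp (a i) / Z - p i := by
          field_simp
        rw [h3] at h2
        linarith
    rw [← Finset.sum_add_distrib]
    refine (Finset.sum_le_sum fun i _ => key i).trans ?_
    rw [Finset.sum_add_distrib, Finset.sum_sub_distrib, ← Finset.sum_mul, hp1, hsum]
    simp

theorem rho2_lt_iff {X : Type*} {ρ : X → X → ℝ} {d : ℕ} (hd : 0 < d) {δ : ℝ} (hδ : 0 < δ)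
    (φ ψ : Fin d → X) : rho2 ρ φ ψ < δ ↔ ∑ b, ρ (φ b) (ψ b) ^ 2 < d * δ ^ 2 := by
  have hd' : (0 : ℝ) < d := Nat.cast_pos.2 hd
  rw [rho2, Real.sqrt_lt' hδ, one_div, inv_mul_lt_iff₀ hd']

/-- A microstate is determined by its coordinates at `1`, up to few exceptional points. -/
theorem card_exceptional_le {G : Type*} [Group G] {k : ℕ} {ρ : (G → Fin k) → (G → Fin k) → ℝ}
    {α : G → (G → Fin k) → G → Fin k} (hα : ∀ (s : G) (x : G → Fin k) (t : G), α s x t = x (s⁻¹ * t))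
    {η : ℝ} (hη : 0 < η) (hηρ : ∀ x y : G → Fin k, ρ x y < η → x 1 = y 1)
    {F T : Finset G} (hTF : ∀ t ∈ T, t⁻¹ ∈ F) {δ : ℝ} (hδ : 0 < δ) {d : ℕ} (hd : 0 < d)
    {σ : G → Equiv.Perm (Fin d)} {φ : Fin d → G → Fin k} (hφ : φ ∈ MapSet α ρ F δ σ) :
    ((Finset.univ.filter fun b => ∃ t ∈ T, φ b t ≠ φ (σ t⁻¹ b) 1).card : ℝ) ≤
      T.card * (d * (δ / η) ^ 2) := by
  have hone : ∀ t ∈ T, ((Finset.univ.filter fun b => φ b t ≠ φ (σ t⁻¹ b) 1).card : ℝ) ≤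
      d * (δ / η) ^ 2 := by
    intro t ht
    have h := (rho2_lt_iff hd hδ _ _).1 (hφ t⁻¹ (hTF t ht))
    rw [div_pow, ← mul_div_assoc, le_div_iff₀ (by positivity), ← nsmul_eq_mul]
    refine le_trans ?_ h.le
    rw [← Finset.sum_const]
    calc _ ≤ ∑ b ∈ Finset.univ.filter fun b => φ b t ≠ φ (σ t⁻¹ b) 1,
          ρ (α t⁻¹ (φ b)) (φ (σ t⁻¹ b)) ^ 2 := by
          refine Finset.sum_le_sum fun b hb => ?_
          have hb' : η ≤ ρ (α t⁻¹ (φ b)) (φ (σ t⁻¹ b)) := by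
            by_contra! hlt
            have := hηρ _ _ hlt
            rw [hα, inv_inv, mul_one] at this
            exact (Finset.mem_filter.1 hb).2 this
          gcongr
      _ ≤ _ := Finset.sum_le_univ_sum_of_nonneg fun b => sq_nonneg _
  have hsub : (Finset.univ.filter fun b => ∃ t ∈ T, φ b t ≠ φ (σ t⁻¹ b) 1) ⊆
      T.biUnion fun t => Finset.univ.filter fun b => φ b t ≠ φ (σ t⁻¹ b) 1 := by
    intro b hb
    simpa using hb
  calc _ ≤ ((T.biUnion fun t => Finset.univ.filter fun b => φ b t ≠ φ (σ t⁻¹ b) 1).card : ℝ) := by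
        exact_mod_cast Finset.card_le_card hsub
    _ ≤ ∑ t ∈ T, ((Finset.univ.filter fun b => φ b t ≠ φ (σ t⁻¹ b) 1).card : ℝ) := by
        exact_mod_cast Finset.card_biUnion_le
    _ ≤ ∑ t ∈ T, (d * (δ / η) ^ 2 : ℝ) := Finset.sum_le_sum hone
    _ = _ := by simp

section FullShift

variable {G : Type*} [Group G] {k : ℕ} [TopologicalSpace (Fin k)] [DiscreteTopology (Fin k)]
  {ρ : (G → Fin k) → (G → Fin k) → ℝ} {α : G → (G → Fin k) → G → Fin k}
  {f : (G → Fin k) → ℝ} {a : Fin k → ℝ}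

theorem bddAbove_weightedSums (hρ : IsContPseudoMetric (G → Fin k) ρ) (hf : ∀ x, f x = a (x 1))
    {ε : ℝ} (hε : 0 < ε) (F : Finset G) (δ : ℝ) {d : ℕ} (σ : G → Equiv.Perm (Fin d)) :
    BddAbove {r : ℝ | ∃ E : Finset (Fin d → G → Fin k), ↑E ⊆ MapSet α ρ F δ σ ∧
      (∀ φ ∈ E, ∀ ψ ∈ E, φ ≠ ψ → ε ≤ rhoInf ρ φ ψ) ∧
      r = ∑ φ ∈ E, Real.exp (∑ b, f (φ b))} := by
  obtain ⟨T, hT⟩ := exists_finset_eq_of_le_rhoInf hρ hε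
  refine ⟨(∑ j, Real.exp (a j)) ^ d *
    (Real.exp (0 * d) * (1 + (k : ℝ) ^ T.card * Real.exp (-0)) ^ d), ?_⟩
  rintro r ⟨E, -, hE, rfl⟩
  simp only [hf]
  refine sum_exp_le_of_card_exceptional_le a E T (fun _ b => b) (c := d) le_rfl (hT d E hE)
    fun φ _ => ?_
  exact_mod_cast (Finset.card_filter_le _ _).trans_eq (by simp)

theorem Mval_pos (hρ : IsContPseudoMetric (G → Fin k) ρ) (hf : ∀ x, f x = a (x 1))
    {ε : ℝ} (hε : 0 < ε) {F : Finset G} {δ : ℝ} {d : ℕ} {σ : G → Equiv.Perm (Fin d)}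
    (hne : (MapSet α ρ F δ σ).Nonempty) : 0 < Mval α f ρ ε F δ σ (rhoInf ρ) := by
  obtain ⟨φ, hφ⟩ := hne
  have h : Real.exp (∑ b, f (φ b)) ≤ Mval α f ρ ε F δ σ (rhoInf ρ) := by
    refine le_csSup (bddAbove_weightedSums hρ hf hε F δ σ) ⟨{φ}, by simpa using hφ, ?_, by simp⟩
    intro ψ hψ χ hχ hne
    rw [Finset.mem_singleton] at hψ hχ
    exact absurd (hψ.trans hχ.symm) hne
  exact (Real.exp_pos _).trans_le h

theorem exists_Mval_le (hα : ∀ (s : G) (x : G → Fin k) (t : G), α s x t = x (s⁻¹ * t))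
    (hρ : IsCompatMetric (G → Fin k) ρ) (hf : ∀ x, f x = a (x 1))
    {ε θ : ℝ} (hε : 0 < ε) (hθ : 0 < θ) :
    ∃ F : Finset G, F.Nonempty ∧ ∃ δ : ℝ, 0 < δ ∧ ∀ (d : ℕ) (σ : G → Equiv.Perm (Fin d)), 0 < d →
      Mval α f ρ ε F δ σ (rhoInf ρ) ≤ (∑ j, Real.exp (a j)) ^ d * Real.exp (d * θ) := by
  obtain ⟨T, hT⟩ := exists_finset_eq_of_le_rhoInf hρ.toIsContPseudoMetric hε
  obtain ⟨η, hη, hηρ⟩ := hρ.exists_pos_apply_eq (1 : G)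
  set M : ℝ := (k : ℝ) ^ T.card with hM
  have hM0 : 0 ≤ M := by positivity
  have hx : 1 ≤ 1 + 2 * M / θ := by
    have : 0 ≤ 2 * M / θ := by positivity
    linarith
  set l : ℝ := Real.log (1 + 2 * M / θ) with hl
  have hl0 : 0 ≤ l := Real.log_nonneg hx
  have hMl : M * Real.exp (-l) ≤ θ / 2 := by
    rw [Real.exp_neg, hl, Real.exp_log (by linarith), ← div_eq_mul_inv, div_le_iff₀ (by linarith)]
    have : θ / 2 * (1 + 2 * M / θ) = θ / 2 + M := by field_simp
    linarith
  set κ : ℝ := θ / (2 * (l + 1) * (T.card + 1)) with hκ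
  have hκ0 : 0 < κ := by positivity
  have hκl : l * (T.card * κ) ≤ θ / 2 := by
    have h1 : l * T.card ≤ (l + 1) * (T.card + 1) := by
      have : (0 : ℝ) ≤ T.card := Nat.cast_nonneg _
      nlinarith
    have h2 : (l + 1) * (T.card + 1) * κ = θ / 2 := by
      rw [hκ]
      field_simp
    nlinarith
  refine ⟨insert 1 (T.image (·⁻¹)), Finset.insert_nonempty _ _, η * Real.sqrt κ,
    by positivity, fun d σ hd => ?_⟩
  refine csSup_le ⟨0, ∅, by simp, by simp, by simp⟩ ?_
  rintro r ⟨E, hEM, hE, rfl⟩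
  simp only [hf]
  refine (sum_exp_le_of_card_exceptional_le a E T (fun t b => σ t⁻¹ b) hl0 (hT d E hE)
    fun φ hφ => card_exceptional_le hα hη hηρ ?_ (by positivity) hd (hEM hφ)).trans ?_
  · intro t ht
    exact Finset.mem_insert_of_mem (Finset.mem_image_of_mem _ ht)
  · refine mul_le_mul_of_nonneg_left ?_
      (pow_nonneg (Finset.sum_nonneg fun _ _ => (Real.exp_pos _).le) _)
    have h1 : (1 + M * Real.exp (-l)) ^ d ≤ Real.exp (d * (M * Real.exp (-l))) := by
      rw [Real.exp_nat_mul]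
      refine pow_le_pow_left₀ (by positivity) ?_ d
      linarith [Real.add_one_le_exp (M * Real.exp (-l))]
    refine (mul_le_mul_of_nonneg_left h1 (Real.exp_pos _).le).trans ?_
    rw [← Real.exp_add, Real.exp_le_exp, mul_div_cancel_left₀ _ hη.ne', Real.sq_sqrt hκ0.le]
    have hd0 : (0 : ℝ) ≤ d := Nat.cast_nonneg _
    nlinarith [mul_le_mul_of_nonneg_left hκl hd0, mul_le_mul_of_nonneg_left hMl hd0]

/-- Pulling back a word along a sofic approximation yields a microstate. -/
theorem eventually_pullback_mem_MapSet
    (hα : ∀ (s : G) (x : G → Fin k) (t : G), α s x t = x (s⁻¹ * t))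
    (hρ : IsContPseudoMetric (G → Fin k) ρ) {d : ℕ → ℕ} {σ : ∀ i, G → Equiv.Perm (Fin (d i))}
    (hσ : IsSoficApprox G d σ) (F : Finset G) {δ : ℝ} (hδ : 0 < δ) :
    ∀ᶠ i in atTop, ∀ w : Fin (d i) → Fin k,
      (fun b t => w (σ i t⁻¹ b)) ∈ MapSet α ρ F δ (σ i) := by
  obtain ⟨D, hD⟩ := hρ.exists_bound
  obtain ⟨T, hT⟩ := hρ.exists_finset_lt (half_pos hδ)
  set κ : ℝ := δ ^ 2 / (2 * (T.card * D ^ 2 + 1)) with hκ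
  have hκ0 : 0 < κ := by positivity
  have hev : ∀ᶠ i in atTop, ∀ s ∈ F, ∀ t ∈ T, 1 - κ <
      ((Finset.univ.filter fun b : Fin (d i) =>
        σ i t⁻¹ (σ i s b) = σ i (t⁻¹ * s) b).card : ℝ) / (d i : ℝ) := by
    refine (Filter.eventually_all_finset F).2 fun s _ => (Filter.eventually_all_finset T).2
      fun t _ => (hσ.mul t⁻¹ s).eventually_const_lt (by linarith)
  filter_upwards [hev, hσ.dim_top.eventually_gt_atTop 0] with i hi hd w s hs
  have hd' : (0 : ℝ) < d i := Nat.cast_pos.2 hd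
  have hbad : ∀ t ∈ T, ((Finset.univ.filter fun b : Fin (d i) =>
      ¬ σ i t⁻¹ (σ i s b) = σ i (t⁻¹ * s) b).card : ℝ) ≤ κ * d i := by
    intro t ht
    have h1 := hi s hs t ht
    rw [lt_div_iff₀ hd'] at h1
    have h2 : ((Finset.univ.filter fun b : Fin (d i) =>
        σ i t⁻¹ (σ i s b) = σ i (t⁻¹ * s) b).card : ℝ) + ((Finset.univ.filter fun b : Fin (d i) =>
        ¬ σ i t⁻¹ (σ i s b) = σ i (t⁻¹ * s) b).card : ℝ) = d i := by
      have := Finset.card_filter_add_card_filter_not (s := (Finset.univ : Finset (Fin (d i))))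
        (fun b => σ i t⁻¹ (σ i s b) = σ i (t⁻¹ * s) b)
      rw [Finset.card_univ, Fintype.card_fin] at this
      exact_mod_cast this
    linarith
  have hpt : ∀ b : Fin (d i),
      ρ (α s fun t => w (σ i t⁻¹ b)) (fun t => w (σ i t⁻¹ (σ i s b))) ^ 2 ≤
        (δ / 2) ^ 2 + ∑ t ∈ T, if ¬ σ i t⁻¹ (σ i s b) = σ i (t⁻¹ * s) b then D ^ 2 else 0 := by
    intro b
    by_cases hb : ∀ t ∈ T, σ i t⁻¹ (σ i s b) = σ i (t⁻¹ * s) b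
    · have h1 := hT (α s fun t => w (σ i t⁻¹ b)) (fun t => w (σ i t⁻¹ (σ i s b))) fun t ht => by
        rw [hα, hb t ht, mul_inv_rev, inv_inv]
      have h2 : 0 ≤ ∑ t ∈ T, if ¬ σ i t⁻¹ (σ i s b) = σ i (t⁻¹ * s) b then D ^ 2 else 0 :=
        Finset.sum_nonneg fun t _ => by split_ifs <;> positivity
      have h3 := pow_le_pow_left₀ (hρ.nonneg _ _) h1.le 2
      linarith
    · push Not at hb
      obtain ⟨t, ht, hne⟩ := hb
      have h1 : D ^ 2 ≤ ∑ t ∈ T, if ¬ σ i t⁻¹ (σ i s b) = σ i (t⁻¹ * s) b then D ^ 2 else 0 := by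
        refine le_trans ?_ (Finset.single_le_sum (fun t _ => ?_) ht)
        · rw [if_pos hne]
        · split_ifs <;> positivity
      have h3 := pow_le_pow_left₀ (hρ.nonneg _ _) (hD (α s fun t => w (σ i t⁻¹ b))
        (fun t => w (σ i t⁻¹ (σ i s b)))) 2
      nlinarith
  rw [rho2_lt_iff hd hδ]
  calc _ ≤ ∑ b : Fin (d i), ((δ / 2) ^ 2 +
        ∑ t ∈ T, if ¬ σ i t⁻¹ (σ i s b) = σ i (t⁻¹ * s) b then D ^ 2 else 0) :=
        Finset.sum_le_sum fun b _ => hpt b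
    _ = d i * (δ / 2) ^ 2 + ∑ t ∈ T, ((Finset.univ.filter fun b : Fin (d i) =>
          ¬ σ i t⁻¹ (σ i s b) = σ i (t⁻¹ * s) b).card : ℝ) * D ^ 2 := by
        rw [Finset.sum_add_distrib, Finset.sum_comm]
        simp only [← Finset.sum_filter, Finset.sum_const, nsmul_eq_mul, Finset.card_univ,
          Fintype.card_fin]
    _ ≤ d i * (δ / 2) ^ 2 + ∑ t ∈ T, κ * d i * D ^ 2 := by
        gcongr with t ht
        exact hbad t ht
    _ = d i * ((δ / 2) ^ 2 + T.card * D ^ 2 * κ) := by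
        rw [Finset.sum_const, nsmul_eq_mul]
        ring
    _ < d i * δ ^ 2 := by
        refine mul_lt_mul_of_pos_left ?_ hd'
        have h2 : (T.card * D ^ 2 + 1) * κ = δ ^ 2 / 2 := by
          rw [hκ]
          field_simp
        nlinarith

theorem exists_eventually_le_Mval
    (hα : ∀ (s : G) (x : G → Fin k) (t : G), α s x t = x (s⁻¹ * t))
    (hρ : IsCompatMetric (G → Fin k) ρ) (hf : ∀ x, f x = a (x 1))
    {d : ℕ → ℕ} {σ : ∀ i, G → Equiv.Perm (Fin (d i))} (hσ : IsSoficApprox G d σ) :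
    ∃ ε : ℝ, 0 < ε ∧ ∀ (F : Finset G) (δ : ℝ), 0 < δ → ∀ᶠ i in atTop,
      (∑ j, Real.exp (a j)) ^ d i ≤ Mval α f ρ ε F δ (σ i) (rhoInf ρ) := by
  obtain ⟨η, hη, hηρ⟩ := hρ.exists_pos_apply_eq (1 : G)
  refine ⟨η, hη, fun F δ hδ => ?_⟩
  filter_upwards [eventually_pullback_mem_MapSet hα hρ.toIsContPseudoMetric hσ F hδ] with i hi
  let Ψ : (Fin (d i) → Fin k) → Fin (d i) → G → Fin k := fun w b t => w (σ i t⁻¹ b)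
  have hΨ : Function.Injective Ψ := by
    intro w v h
    funext b
    have := congrFun (congrFun h ((σ i 1⁻¹).symm b)) 1
    simpa [Ψ] using this
  refine le_csSup (bddAbove_weightedSums hρ.toIsContPseudoMetric hf hη F δ (σ i))
    ⟨Finset.univ.image Ψ, ?_, ?_, ?_⟩
  · intro φ hφ
    obtain ⟨w, -, rfl⟩ := Finset.mem_image.1 (Finset.mem_coe.1 hφ)
    exact hi w
  · intro φ _ ψ _ hne
    by_contra! hlt
    simp only [Finset.mem_image, Finset.mem_univ, true_and] at *
    rename_i hφ hψ
    obtain ⟨w, rfl⟩ := hφ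
    obtain ⟨v, rfl⟩ := hψ
    refine hne (congrArg Ψ (funext fun b => ?_))
    have h1 : ρ (Ψ w ((σ i 1⁻¹).symm b)) (Ψ v ((σ i 1⁻¹).symm b)) < η :=
      (le_ciSup (f := fun c => ρ (Ψ w c) (Ψ v c)) (Set.finite_range _).bddAbove _).trans_lt hlt
    simpa [Ψ] using hηρ _ _ h1
  · rw [Finset.sum_image fun _ _ _ _ h => hΨ h, Fintype.sum_pow]
    simp only [hf, Ψ, Real.exp_sum]
    exact Finset.sum_congr rfl fun w _ =>
      (Equiv.prod_comp (σ i 1⁻¹) fun b => Real.exp (a (w b))).symm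

end FullShift

theorem stmt10 {G : Type*} [Group G] [Countable G]
    (d : ℕ → ℕ) (σ : ∀ i, G → Equiv.Perm (Fin (d i))) (hσ : IsSoficApprox G d σ)
    (k : ℕ) (hk : 0 < k) [TopologicalSpace (Fin k)] [DiscreteTopology (Fin k)]
    (a : Fin k → ℝ)
    (α : G → (G → Fin k) → G → Fin k)
    (hα : ∀ (s : G) (x : G → Fin k) (t : G), α s x t = x (s⁻¹ * t))
    (f : (G → Fin k) → ℝ) (hfdef : ∀ x, f x = a (x 1))
    (ρ : (G → Fin k) → (G → Fin k) → ℝ) (hρ : IsCompatMetric (G → Fin k) ρ) :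
    PressureInf α f ρ d σ = ((Real.log (∑ j, Real.exp (a j)) : ℝ) : EReal) ∧
    Real.log (∑ j, Real.exp (a j)) =
      sSup {r : ℝ | ∃ p : Fin k → ℝ, (∀ i, 0 ≤ p i) ∧ (∑ i, p i) = 1 ∧
        r = (∑ i, -(p i * Real.log (p i))) + ∑ i, p i * a i} := by
  have : Nonempty (Fin k) := ⟨⟨0, hk⟩⟩
  have hZ : 0 < ∑ j, Real.exp (a j) :=
    Finset.sum_pos (fun _ _ => Real.exp_pos _) Finset.univ_nonempty
  refine ⟨le_antisymm ?_ ?_, (isGreatest_log_sum_exp a).csSup_eq.symm⟩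
  · refine iSup₂_le fun ε hε => EReal.le_of_forall_lt_iff_le.1 fun z hz => ?_
    obtain ⟨F, hF, δ, hδ, hM⟩ := exists_Mval_le hα hρ hfdef hε
      (sub_pos.2 (EReal.coe_lt_coe_iff.1 hz))
    refine (iInf₂_le F hF).trans ((iInf₂_le δ hδ).trans (Filter.limsup_le_of_le ?_ ?_))
    · isBoundedDefault
    · filter_upwards [hσ.dim_top.eventually_gt_atTop 0] with i hd
      split_ifs with hne
      · have hd' : (0 : ℝ) < d i := Nat.cast_pos.2 hd
        have hlog := Real.log_le_log
          (Mval_pos hρ.toIsContPseudoMetric hfdef hε hne) (hM (d i) (σ i) hd)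
        rw [Real.log_mul (by positivity) (by positivity), Real.log_pow, Real.log_exp] at hlog
        rw [EReal.coe_le_coe_iff, div_le_iff₀ hd']
        linarith
      · exact bot_le
  · obtain ⟨ε, hε, h⟩ := exists_eventually_le_Mval hα hρ hfdef hσ
    refine le_trans ?_ (le_iSup₂ ε hε)
    refine le_iInf₂ fun F _ => le_iInf₂ fun δ hδ =>
      Filter.le_limsup_of_frequently_le (Filter.Eventually.frequently ?_) ?_
    · filter_upwards [h F δ hδ, hσ.dim_top.eventually_gt_atTop 0,
        eventually_pullback_mem_MapSet hα hρ.toIsContPseudoMetric hσ F hδ] with i hi hd hmem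
      have hd' : (0 : ℝ) < d i := Nat.cast_pos.2 hd
      rw [if_pos ⟨_, hmem fun _ => ⟨0, hk⟩⟩, EReal.coe_le_coe_iff, le_div_iff₀ hd', mul_comm,
        ← Real.log_pow]
      exact Real.log_le_log (by positivity) hi
    · isBoundedDefault

end Sofic
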